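/- Let G be a dihedral group of order 2n for some odd n ≥ 3. Then {1, 2, n−2, 2n−2} ⊆ Δ*(G) and max(Δ*(G) \ {2n−2}) = max{2, n−2}. -/

import Mathlib

namespace ProductOne

open scoped Classical

variable {G : Type*} [Group G]

/-- `S` is a product-one sequence over `G`: its terms can be ordered with product `1`. -/
def IsProductOne (S : Multiset G) : Prop :=
  ∃ l : List G, (l : Multiset G) = S ∧ l.prod = 1

/-- `S` is an atom (a minimal product-one sequence): it is a nontrivial product-one
sequence that is not the concatenation of two nontrivial product-one sequences. -/
def IsAtomSeq (S : Multiset G) : Prop :=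
  S ≠ 0 ∧ IsProductOne S ∧
    ∀ A B : Multiset G, S = A + B → IsProductOne A → IsProductOne B → A = 0 ∨ B = 0

/-- `S` is a sequence over the subset `G₀ ⊆ G`. -/
def SeqOn (G₀ : Set G) (S : Multiset G) : Prop := ∀ g ∈ S, g ∈ G₀

/-- `S` is an atom of the monoid `B(G₀)` of product-one sequences over `G₀`. -/
def IsAtomSeqOn (G₀ : Set G) (S : Multiset G) : Prop := SeqOn G₀ S ∧ IsAtomSeq S

/-- The set of lengths `L(A)` of factorizations of `A` into atoms over `G₀`. -/
def lengthsOn (G₀ : Set G) (A : Multiset G) : Set ℕ :=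
  {k | ∃ f : Multiset (Multiset G), Multiset.card f = k ∧
        (∀ U ∈ f, IsAtomSeqOn G₀ U) ∧ f.sum = A}

/-- The set of lengths `L(A)` over the whole group. -/
def lengths (A : Multiset G) : Set ℕ := lengthsOn Set.univ A

/-- The set of distances of a set `L ⊆ ℕ`. -/
def distancesOf (L : Set ℕ) : Set ℕ :=
  {d | 0 < d ∧ ∃ a, a ∈ L ∧ a + d ∈ L ∧ ∀ b ∈ L, ¬(a < b ∧ b < a + d)}

/-- The set of distances `Δ(G₀)` of the monoid `B(G₀)`. -/
def DeltaOn (G₀ : Set G) : Set ℕ :=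
  {d | ∃ A : Multiset G, SeqOn G₀ A ∧ IsProductOne A ∧ d ∈ distancesOf (lengthsOn G₀ A)}

/-- The set of distances `Δ(G)` of `B(G)`. -/
def Delta (G : Type*) [Group G] : Set ℕ := DeltaOn (Set.univ : Set G)

/-- The large Davenport constant of `G₀`: maximal length of an atom of `B(G₀)`. -/
noncomputable def DavenportOn (G₀ : Set G) : ℕ :=
  sSup {k | ∃ S : Multiset G, IsAtomSeqOn G₀ S ∧ Multiset.card S = k}

/-- The large Davenport constant `D(G)`. -/
noncomputable def Davenport (G : Type*) [Group G] : ℕ :=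
  DavenportOn (Set.univ : Set G)

/-- The small Davenport constant `d(G₀)`: maximal length of a product-one free
sequence over `G₀`. -/
noncomputable def smallDavenportOn (G₀ : Set G) : ℕ :=
  sSup {k | ∃ S : Multiset G, SeqOn G₀ S ∧ Multiset.card S = k ∧
        ∀ T : Multiset G, T ≤ S → T ≠ 0 → ¬IsProductOne T}

/-- `Δ*(G) = {min Δ(G₀) : G₀ ⊆ G with Δ(G₀) ≠ ∅}`. -/
def DeltaStar (G : Type*) [Group G] : Set ℕ :=
  {d | ∃ G₀ : Set G, (DeltaOn G₀).Nonempty ∧ d = sInf (DeltaOn G₀)}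

/-- The elasticity `ρ(L) = max L / min L` of a set of lengths (with the set of
positive elements used, and `ρ = 1` if there are none). -/
noncomputable def elasticity (L : Set ℕ) : ℚ :=
  if (L ∩ {k | 0 < k}).Nonempty then
    ((sSup (L ∩ {k | 0 < k}) : ℕ) : ℚ) / ((sInf (L ∩ {k | 0 < k}) : ℕ) : ℚ)
  else 1

/-- The elasticity `ρ(G₀)` of the monoid `B(G₀)`. -/
noncomputable def rhoOn (G₀ : Set G) : ℝ :=
  sSup {x : ℝ | ∃ A : Multiset G, SeqOn G₀ A ∧ IsProductOne A ∧
    x = (elasticity (lengthsOn G₀ A) : ℝ)}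

/-- `Δ*_ρ(G) = {min Δ(G₀) : G₀ ⊆ G with ρ(G₀) = D(G)/2}`. -/
noncomputable def DeltaRhoStar (G : Type*) [Group G] : Set ℕ :=
  {d | ∃ G₀ : Set G, rhoOn G₀ = (Davenport G : ℝ) / 2 ∧ d = sInf (DeltaOn G₀)}

/-- Divisibility in the monoid `B(G)`. -/
def BDvd (A S : Multiset G) : Prop :=
  ∃ C : Multiset G, IsProductOne C ∧ S = A + C

/-- The `ω`-invariant `ω(B(G), A)`. -/
noncomputable def omegaAt (A : Multiset G) : ℕ∞ :=
  sInf {N : ℕ∞ | ∀ f : Multiset (Multiset G),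
    (∀ B ∈ f, IsProductOne B) → BDvd A f.sum →
    ∃ t ≤ f, (Multiset.card t : ℕ∞) ≤ N ∧ BDvd A t.sum}

/-- `ω(G) = sup {ω(B(G), U) : U an atom of B(G)}`. -/
noncomputable def omegaInv (G : Type*) [Group G] : ℕ∞ :=
  ⨆ U ∈ {U : Multiset G | IsAtomSeq U}, omegaAt U

/-- `z` is a factorization of `A` into atoms. -/
def IsFactorization (A : Multiset G) (z : Multiset (Multiset G)) : Prop :=
  (∀ U ∈ z, IsAtomSeq U) ∧ z.sum = A

/-- The distance between two factorizations. -/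
noncomputable def factDist (z z' : Multiset (Multiset G)) : ℕ :=
  letI := Classical.decEq (Multiset G)
  max (Multiset.card (z - z')) (Multiset.card (z' - z))

/-- The catenary degree `c(A)`. -/
noncomputable def catenaryAt (A : Multiset G) : ℕ∞ :=
  sInf {N : ℕ∞ | ∀ z z' : Multiset (Multiset G),
    IsFactorization A z → IsFactorization A z' →
    Relation.ReflTransGen
      (fun x y => IsFactorization A y ∧ (factDist x y : ℕ∞) ≤ N) z z'}

/-- The set of positive catenary degrees `Ca(G)`. -/
noncomputable def CatenarySet (G : Type*) [Group G] : Set ℕ∞ :=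
  {c | ∃ A : Multiset G, IsProductOne A ∧ catenaryAt A = c ∧ 0 < c}

/-- The catenary degree `c(G)` of `B(G)`. -/
noncomputable def catenaryDegree (G : Type*) [Group G] : ℕ∞ :=
  ⨆ A ∈ {A : Multiset G | IsProductOne A}, catenaryAt A

/-- The cross number `k(S)` of a sequence. -/
noncomputable def crossNumber (S : Multiset G) : ℚ :=
  (S.map fun g => (1 : ℚ) / (orderOf g : ℚ)).sum

/-- The system of sets of lengths `L(G)`. -/
def LSystem (G : Type*) [Group G] : Set (Set ℕ) :=
  {L | ∃ A : Multiset G, IsProductOne A ∧ L = lengths A}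

/-- The set of products `π(S)` of all orderings of the terms of `S`. -/
def piSet (S : Multiset G) : Set G :=
  {g | ∃ l : List G, (l : Multiset G) = S ∧ l.prod = g}

/-- The sumset `{x₁, -x₁} + ⋯ + {x_s, -x_s}` for a sequence `a = x₁ ⋯ x_s`. -/
def signedSums {α : Type*} [AddCommGroup α] (a : Multiset α) : Set α :=
  {z | ∃ t ≤ a, z = t.sum + t.sum - a.sum}

/-- `Σ_k(T)`: the set of sums of `k`-term subsequences of `T`. -/
def subseqSums {α : Type*} [AddCommMonoid α] (k : ℕ) (T : Multiset α) : Set α :=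
  {z | ∃ t ≤ T, Multiset.card t = k ∧ t.sum = z}

/-- The subsequence `S_X` of all terms of `S` lying in `X`. -/
noncomputable def restrictTo (X : Set G) (S : Multiset G) : Multiset G :=
  letI := Classical.decPred fun g => g ∈ X
  S.filter fun g => g ∈ X

/-- The maximum multiplicity `h(S)` of a term of `S`. -/
noncomputable def maxMultiplicity {α : Type*} (S : Multiset α) : ℕ :=
  letI := Classical.decEq α
  S.toFinset.sup S.count

end ProductOne

namespace ProductOne

section Monoid

variable {G : Type*} [Group G] {G₀ : Set G}

lemma isProductOne_zero : IsProductOne (0 : Multiset G) := ⟨[], rfl, rfl⟩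

lemma IsProductOne.add {A B : Multiset G} (hA : IsProductOne A) (hB : IsProductOne B) :
    IsProductOne (A + B) := by
  obtain ⟨l, rfl, hl⟩ := hA
  obtain ⟨m, rfl, hm⟩ := hB
  exact ⟨l ++ m, rfl, by simp [hl, hm]⟩

/-- A term equal to `1` may be removed from a product-one sequence. -/
lemma IsProductOne.of_one_cons {S : Multiset G} (h : IsProductOne (1 ::ₘ S)) :
    IsProductOne S := by
  obtain ⟨l, hl, hp⟩ := h
  have h1 : (1 : G) ∈ l := by
    rw [← Multiset.mem_coe, hl]
    exact Multiset.mem_cons_self _ _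
  obtain ⟨a, b, rfl⟩ := List.append_of_mem h1
  refine ⟨a ++ b, ?_, by simpa using hp⟩
  have : (1 : G) ::ₘ ((a ++ b : List G) : Multiset G) = 1 ::ₘ S := by
    rw [← hl, Multiset.cons_coe, Multiset.coe_eq_coe]
    exact List.perm_middle.symm
  exact (Multiset.cons_inj_right _).1 this

lemma IsAtomSeq.eq_of_add {U A B : Multiset G} (hU : IsAtomSeq U) (h : U = A + B)
    (hA : IsProductOne A) (hB : IsProductOne B) (hA0 : A ≠ 0) : U = A := by
  rcases hU.2.2 A B h hA hB with h0 | h0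
  · exact absurd h0 hA0
  · simp [h, h0]

lemma IsAtomSeq.eq_singleton_one {U : Multiset G} (hU : IsAtomSeq U) (h1 : (1 : G) ∈ U) :
    U = {1} := by
  obtain ⟨T, rfl⟩ := Multiset.exists_cons_of_mem h1
  exact hU.eq_of_add (Multiset.singleton_add _ _).symm ⟨[1], rfl, by simp⟩
    hU.2.1.of_one_cons (by simp)

lemma IsProductOne.exists_factorization {S : Multiset G} (hS : IsProductOne S)
    (hon : SeqOn G₀ S) : ∃ f : Multiset (Multiset G), (∀ U ∈ f, IsAtomSeqOn G₀ U) ∧ f.sum = S := by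
  induction hc : Multiset.card S using Nat.strong_induction_on generalizing S with
  | _ c ih =>
    by_cases h0 : S = 0
    · exact ⟨0, by simp, by simp [h0]⟩
    by_cases hat : IsAtomSeq S
    · exact ⟨{S}, by simpa using ⟨hon, hat⟩, by simp⟩
    · simp only [IsAtomSeq, not_and, not_forall, not_or] at hat
      obtain ⟨A, B, hAB, hA, hB, hA0, hB0⟩ := hat h0 hS
      subst hAB
      have hcA := Multiset.card_pos.2 hA0
      have hcB := Multiset.card_pos.2 hB0
      rw [Multiset.card_add] at hc
      obtain ⟨f, hf, rfl⟩ := ih _ (by omega) hA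
        (fun g hg => hon g (Multiset.mem_add.2 (Or.inl hg))) rfl
      obtain ⟨f', hf', rfl⟩ := ih _ (by omega) hB
        (fun g hg => hon g (Multiset.mem_add.2 (Or.inr hg))) rfl
      refine ⟨f + f', fun U hU => ?_, by simp⟩
      rcases Multiset.mem_add.1 hU with h | h
      exacts [hf U h, hf' U h]

lemma isProductOne_sum {f : Multiset (Multiset G)} (hf : ∀ U ∈ f, IsAtomSeqOn G₀ U) :
    IsProductOne f.sum ∧ SeqOn G₀ f.sum := by
  induction f using Multiset.induction_on with
  | empty => exact ⟨isProductOne_zero, by simp [SeqOn]⟩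
  | cons U f ih =>
    obtain ⟨h1, h2⟩ := ih fun V hV => hf V (Multiset.mem_cons_of_mem hV)
    have hU := hf U (Multiset.mem_cons_self _ _)
    rw [Multiset.sum_cons]
    refine ⟨hU.2.2.1.add h1, fun g hg => ?_⟩
    rcases Multiset.mem_add.1 hg with h | h
    exacts [hU.1 g h, h2 g h]

lemma zero_mem_lengthsOn : 0 ∈ lengthsOn G₀ (0 : Multiset G) := ⟨0, by simp⟩

lemma add_mem_lengthsOn {A B : Multiset G} {k l : ℕ} (hk : k ∈ lengthsOn G₀ A)
    (hl : l ∈ lengthsOn G₀ B) : k + l ∈ lengthsOn G₀ (A + B) := by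
  obtain ⟨f, rfl, hf, rfl⟩ := hk
  obtain ⟨f', rfl, hf', rfl⟩ := hl
  refine ⟨f + f', by simp, fun U hU => ?_, by simp⟩
  rcases Multiset.mem_add.1 hU with h | h
  exacts [hf U h, hf' U h]

lemma nsmul_mem_lengthsOn {A : Multiset G} {k : ℕ} (m : ℕ) (hk : k ∈ lengthsOn G₀ A) :
    m * k ∈ lengthsOn G₀ (m • A) := by
  induction m with
  | zero => simpa using zero_mem_lengthsOn
  | succ m ih => simpa [succ_nsmul, Nat.succ_mul] using add_mem_lengthsOn ih hk

lemma one_mem_lengthsOn {U : Multiset G} (hU : IsAtomSeqOn G₀ U) : 1 ∈ lengthsOn G₀ U :=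
  ⟨{U}, by simp, by simpa using hU, by simp⟩

/-- The group of differences of lengths of factorizations of elements of `B(G₀)`. -/
def lengthDiffs (G₀ : Set G) : AddSubgroup ℤ where
  carrier := {d | ∃ A : Multiset G, ∃ k ∈ lengthsOn G₀ A, ∃ l ∈ lengthsOn G₀ A, d = k - l}
  zero_mem' := ⟨0, 0, zero_mem_lengthsOn, 0, zero_mem_lengthsOn, by simp⟩
  add_mem' := by
    rintro _ _ ⟨A, k, hk, l, hl, rfl⟩ ⟨B, k', hk', l', hl', rfl⟩
    exact ⟨A + B, k + k', add_mem_lengthsOn hk hk', l + l', add_mem_lengthsOn hl hl', by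
      push_cast; ring⟩
  neg_mem' := by
    rintro _ ⟨A, k, hk, l, hl, rfl⟩
    exact ⟨A, l, hl, k, hk, by ring⟩

lemma sub_mem_lengthDiffs {A : Multiset G} {k l : ℕ} (hk : k ∈ lengthsOn G₀ A)
    (hl : l ∈ lengthsOn G₀ A) : (k - l : ℤ) ∈ lengthDiffs G₀ := ⟨A, k, hk, l, hl, rfl⟩

lemma pos_and_mem_lengthDiffs_of_mem_deltaOn {d : ℕ} (hd : d ∈ DeltaOn G₀) :
    0 < d ∧ (d : ℤ) ∈ lengthDiffs G₀ := by
  obtain ⟨A, -, -, hpos, a, ha, had, -⟩ := hd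
  exact ⟨hpos, by simpa using sub_mem_lengthDiffs had ha⟩

lemma exists_mem_deltaOn_le {d : ℕ} (hpos : 0 < d) (hd : (d : ℤ) ∈ lengthDiffs G₀) :
    ∃ e ∈ DeltaOn G₀, e ≤ d := by
  induction d using Nat.strong_induction_on with
  | _ d ih =>
    obtain ⟨A, k, hk, l, hl, hkl⟩ := hd
    obtain rfl : k = l + d := by omega
    by_cases h : ∃ b ∈ lengthsOn G₀ A, l < b ∧ b < l + d
    · obtain ⟨b, hb, h1, h2⟩ := h
      obtain ⟨e, he, hle⟩ := ih (b - l) (by omega) (by omega)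
        (by simpa [Nat.cast_sub h1.le] using sub_mem_lengthDiffs hb hl)
      exact ⟨e, he, by omega⟩
    · push Not at h
      refine ⟨d, ⟨A, ?_, ?_, hpos, l, hl, hk, fun b hb hlt => ?_⟩, le_rfl⟩
      · obtain ⟨f, -, hf, rfl⟩ := hl
        exact (isProductOne_sum hf).2
      · obtain ⟨f, -, hf, rfl⟩ := hl
        exact (isProductOne_sum hf).1
      · exact absurd hlt.2 (not_lt.2 (h b hb hlt.1))

lemma sInf_deltaOn_le {d : ℕ} (hpos : 0 < d) (hd : (d : ℤ) ∈ lengthDiffs G₀) :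
    sInf (DeltaOn G₀) ≤ d := by
  obtain ⟨e, he, hle⟩ := exists_mem_deltaOn_le hpos hd
  exact (Nat.sInf_le he).trans hle

lemma mem_deltaStar_of_lengthDiffs {m : ℕ} (hpos : 0 < m) (hm : (m : ℤ) ∈ lengthDiffs G₀)
    (hdvd : ∀ h ∈ lengthDiffs G₀, (m : ℤ) ∣ h) : m ∈ DeltaStar G := by
  obtain ⟨e, he, hle⟩ := exists_mem_deltaOn_le hpos hm
  have hne : (DeltaOn G₀).Nonempty := ⟨e, he⟩
  obtain ⟨hp, hmem⟩ := pos_and_mem_lengthDiffs_of_mem_deltaOn (Nat.sInf_mem hne)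
  refine ⟨G₀, hne, le_antisymm ?_ (sInf_deltaOn_le hpos hm)⟩
  exact Nat.le_of_dvd hp (by exact_mod_cast hdvd _ hmem)

/-- If a weight function has value `2` modulo `2 * c` on all atoms, then `c` divides all
differences of lengths. -/
lemma dvd_of_mem_lengthDiffs {c : ℤ} (w : G → ℤ)
    (hw : ∀ U, IsAtomSeqOn G₀ U → 2 * c ∣ (U.map w).sum - 2) {h : ℤ}
    (hh : h ∈ lengthDiffs G₀) : c ∣ h := by
  have key : ∀ f : Multiset (Multiset G), (∀ U ∈ f, IsAtomSeqOn G₀ U) →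
      2 * c ∣ (f.sum.map w).sum - 2 * Multiset.card f := by
    intro f
    induction f using Multiset.induction_on with
    | empty => simp
    | cons U f ih =>
      intro hf
      have h1 := hw U (hf U (Multiset.mem_cons_self _ _))
      have h2 := ih fun V hV => hf V (Multiset.mem_cons_of_mem hV)
      obtain ⟨a, ha⟩ := h1
      obtain ⟨b, hb⟩ := h2
      simp only [Multiset.sum_cons, Multiset.map_add, Multiset.sum_add, Multiset.card_cons]
      exact ⟨a + b, by push_cast; linarith⟩
  obtain ⟨A, _, ⟨f, rfl, hf, rfl⟩, _, ⟨f', rfl, hf', h'⟩, rfl⟩ := hh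
  have h1 := key f hf
  have h2 := key f' hf'
  rw [h'] at h2
  have h3 := dvd_sub h2 h1
  rw [show (f.sum.map w).sum - 2 * (Multiset.card f' : ℤ) -
    ((f.sum.map w).sum - 2 * (Multiset.card f : ℤ)) =
      2 * ((Multiset.card f : ℤ) - Multiset.card f') by ring] at h3
  exact Int.dvd_of_mul_dvd_mul_left (by norm_num) h3

/-- A subsequence of a concatenation is already covered by few of the factors. -/
lemma exists_le_sum_of_le_sum {α : Type*} (z : Multiset (Multiset α)) {U : Multiset α}
    (h : U ≤ z.sum) : ∃ t ≤ z, Multiset.card t ≤ Multiset.card U ∧ U ≤ t.sum := by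
  classical
  induction z using Multiset.induction_on generalizing U with
  | empty => exact ⟨0, le_rfl, by simp, by simpa using h⟩
  | cons V z ih =>
    rw [Multiset.sum_cons] at h
    obtain ⟨t, ht, hc, hle⟩ := ih (U := U - V) (by rwa [tsub_le_iff_left])
    by_cases hUV : U - V = U
    · rw [hUV] at hc hle
      exact ⟨t, ht.trans (Multiset.le_cons_self _ _), hc, hle⟩
    · refine ⟨V ::ₘ t, Multiset.cons_le_cons _ ht, ?_, ?_⟩
      · have hlt : U - V < U := lt_of_le_of_ne tsub_le_self hUV
        have := Multiset.card_lt_card hlt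
        rw [Multiset.card_cons]
        omega
      · rw [Multiset.sum_cons, ← tsub_le_iff_left]
        exact hle

lemma card_lt_card_sum_of_lt {t z : Multiset (Multiset G)} (hz : ∀ U ∈ z, IsAtomSeqOn G₀ U)
    (h : t < z) : Multiset.card t.sum < Multiset.card z.sum := by
  obtain ⟨s, rfl⟩ := Multiset.le_iff_exists_add.1 h.le
  have hs : s ≠ 0 := by
    rintro rfl
    simp at h
  obtain ⟨U, hU⟩ := Multiset.exists_mem_of_ne_zero hs
  obtain ⟨s', rfl⟩ := Multiset.exists_cons_of_mem hU
  have := Multiset.card_pos.2 (hz U (by simp)).2.1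
  simp only [Multiset.sum_add, Multiset.sum_cons, Multiset.card_add]
  omega

/-- If complements of product-one subsequences of product-one sequences over `G₀` are again
product-one and all atoms over `G₀` have at most `n` terms, then some positive difference of
lengths is at most `n - 2`. -/
lemma exists_mem_lengthDiffs_le {n : ℕ} (hcard : ∀ U, IsAtomSeqOn G₀ U → Multiset.card U ≤ n)
    (hcancel : ∀ A B : Multiset G, SeqOn G₀ (A + B) → IsProductOne (A + B) → IsProductOne A →
      IsProductOne B)
    (hne : (DeltaOn G₀).Nonempty) :
    ∃ d : ℕ, 0 < d ∧ d ≤ n - 2 ∧ (d : ℤ) ∈ lengthDiffs G₀ := by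
  classical
  have hex : ∃ c, ∃ A : Multiset G, Multiset.card A = c ∧
      ∃ k ∈ lengthsOn G₀ A, ∃ l ∈ lengthsOn G₀ A, k < l := by
    obtain ⟨d, A, -, -, hd, a, ha, had, -⟩ := hne
    exact ⟨_, A, rfl, a, ha, _, had, by omega⟩
  obtain ⟨A, hA, _, ⟨z, rfl, hz, rfl⟩, _, ⟨z', rfl, hz', hzz⟩, hlt⟩ := Nat.find_spec hex
  have hmin : ∀ B : Multiset G, Multiset.card B < Multiset.card z.sum →
      ∀ k ∈ lengthsOn G₀ B, ∀ l ∈ lengthsOn G₀ B, k = l := by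
    intro B hB k hk l hl
    have := Nat.find_min hex (hA ▸ hB)
    push Not at this
    exact le_antisymm (this B rfl l hl k hk) (this B rfl k hk l hl)
  have hz0 : z ≠ 0 := by
    rintro rfl
    obtain ⟨V, hV⟩ := Multiset.exists_mem_of_ne_zero (Multiset.card_pos.1 hlt)
    have h2 := Multiset.le_sum_of_mem hV
    rw [hzz, Multiset.sum_zero] at h2
    exact (hz' V hV).2.1 (Multiset.le_zero.1 h2)
  obtain ⟨U, hU⟩ := Multiset.exists_mem_of_ne_zero hz0
  obtain ⟨y, rfl⟩ := Multiset.exists_cons_of_mem hU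
  have hUat := hz U hU
  have hUpos := Multiset.card_pos.2 hUat.2.1
  rw [Multiset.sum_cons] at hzz hmin
  rw [Multiset.card_cons] at hlt
  have hy : y ≠ 0 := by
    rintro rfl
    obtain ⟨V, hV⟩ := Multiset.exists_mem_of_ne_zero
      (Multiset.card_pos.1 ((Nat.zero_le _).trans_lt hlt))
    obtain ⟨x, rfl⟩ := Multiset.exists_cons_of_mem hV
    have hx := isProductOne_sum fun W hW => hz' W (Multiset.mem_cons_of_mem hW)
    simp only [Multiset.sum_cons, Multiset.sum_zero, add_zero] at hzz
    have hVat := hz' V hV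
    rcases hUat.2.2.2 V x.sum hzz.symm hVat.2.2.1 hx.1 with h | h
    · exact hVat.2.1 h
    · have hx0 : x ≠ 0 := by
        rintro rfl
        simp at hlt
      obtain ⟨W, hW⟩ := Multiset.exists_mem_of_ne_zero hx0
      have h2 := Multiset.le_sum_of_mem hW
      rw [h] at h2
      exact (hz' W (Multiset.mem_cons_of_mem hW)).2.1 (Multiset.le_zero.1 h2)
  have hy1 := Multiset.card_pos.2 hy
  obtain ⟨t, ht, htU, hUt⟩ := exists_le_sum_of_le_sum z' (hzz ▸ Multiset.le_add_right U y.sum)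
  have hteq : t = z' := by
    by_contra hne
    have htz : t < z' := lt_of_le_of_ne ht hne
    have hta : ∀ V ∈ t, IsAtomSeqOn G₀ V := fun V hV => hz' V (Multiset.mem_of_le ht hV)
    obtain ⟨W, hW⟩ := Multiset.le_iff_exists_add.1 hUt
    obtain ⟨htP, htS⟩ := isProductOne_sum hta
    have hWP : IsProductOne W := hcancel U W (hW ▸ htS) (hW ▸ htP) hUat.2.2.1
    obtain ⟨w, hw, rfl⟩ := hWP.exists_factorization (G₀ := G₀)
      (fun g hg => htS g (hW ▸ Multiset.mem_add.2 (Or.inr hg)))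
    have hlt' := card_lt_card_sum_of_lt hz' htz
    rw [hzz] at hlt'
    have h1 : Multiset.card t = 1 + Multiset.card w :=
      hmin _ hlt' _ ⟨t, rfl, hta, rfl⟩ _
        (hW ▸ add_mem_lengthsOn (one_mem_lengthsOn hUat) ⟨w, rfl, hw, rfl⟩)
    obtain ⟨s, rfl⟩ := Multiset.le_iff_exists_add.1 ht
    have hsum : y.sum = w.sum + s.sum := by
      rw [Multiset.sum_add, hW, add_assoc] at hzz
      exact (add_left_cancel hzz).symm
    have h2 : Multiset.card y = Multiset.card w + Multiset.card s :=
      hmin y.sum (by rw [Multiset.card_add]; omega) _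
        ⟨y, rfl, fun V hV => hz V (Multiset.mem_cons_of_mem hV), rfl⟩ _
        (hsum ▸ add_mem_lengthsOn ⟨w, rfl, hw, rfl⟩
          ⟨s, rfl, fun V hV => hz' V (Multiset.mem_add.2 (Or.inr hV)), rfl⟩)
    rw [Multiset.card_add] at hlt
    omega
  subst hteq
  have hUn := hcard U hUat
  refine ⟨Multiset.card t - (Multiset.card y + 1), by omega, by omega, ?_⟩
  have h3 := sub_mem_lengthDiffs (G₀ := G₀) (A := t.sum) (k := Multiset.card t)
    (l := Multiset.card y + 1) ⟨t, rfl, hz', rfl⟩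
    ⟨U ::ₘ y, by simp, hz, by rw [Multiset.sum_cons, hzz]⟩
  rwa [Nat.cast_sub hlt.le]

end Monoid

section SingleElement

variable {G : Type*} [Group G]

lemma isProductOne_replicate_iff {g : G} {k : ℕ} :
    IsProductOne (Multiset.replicate k g) ↔ g ^ k = 1 := by
  constructor
  · rintro ⟨l, hl, hp⟩
    rw [← Multiset.coe_replicate, Multiset.coe_eq_coe, List.perm_replicate] at hl
    simpa [hl] using hp
  · intro h
    exact ⟨List.replicate k g, Multiset.coe_replicate k g, by simpa using h⟩

lemma isAtomSeq_replicate_orderOf {g : G} (hg : IsOfFinOrder g) :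
    IsAtomSeq (Multiset.replicate (orderOf g) g) := by
  have hpos := hg.orderOf_pos
  refine ⟨fun h => ?_, isProductOne_replicate_iff.2 (pow_orderOf_eq_one g), ?_⟩
  · rw [← Multiset.card_eq_zero, Multiset.card_replicate] at h
    omega
  · intro A B hAB hA hB
    have hA' : A = Multiset.replicate (Multiset.card A) g := Multiset.eq_replicate_card.2
      fun b hb => Multiset.eq_of_mem_replicate (hAB ▸ Multiset.mem_add.2 (Or.inl hb))
    have hc := congrArg Multiset.card hAB
    rw [Multiset.card_replicate, Multiset.card_add] at hc
    rw [hA', isProductOne_replicate_iff] at hA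
    obtain ⟨q, hq⟩ := orderOf_dvd_of_pow_eq_one hA
    rcases Nat.eq_zero_or_pos q with rfl | hq0
    · exact Or.inl (Multiset.card_eq_zero.1 (by simpa using hq))
    · have := Nat.le_mul_of_pos_right (orderOf g) hq0
      exact Or.inr (Multiset.card_eq_zero.1 (by omega))

lemma IsAtomSeq.eq_replicate_orderOf {g : G} {U : Multiset G} (hU : IsAtomSeq U)
    (hg : ∀ h ∈ U, h = g) : U = Multiset.replicate (orderOf g) g := by
  obtain ⟨k, rfl⟩ : ∃ k, U = Multiset.replicate k g := ⟨_, Multiset.eq_replicate_card.2 hg⟩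
  have hk0 : k ≠ 0 := by
    rintro rfl
    exact hU.1 rfl
  have hk := orderOf_dvd_of_pow_eq_one (isProductOne_replicate_iff.1 hU.2.1)
  have hle := Nat.le_of_dvd (Nat.pos_of_ne_zero hk0) hk
  have ho : orderOf g ≠ 0 := fun h => hk0 (by simpa [h] using hk)
  obtain ⟨j, rfl⟩ := Nat.exists_eq_add_of_le hle
  refine hU.eq_of_add (Multiset.replicate_add _ _ _)
    (isProductOne_replicate_iff.2 (pow_orderOf_eq_one g)) ?_ fun h => ho ?_
  · rw [isProductOne_replicate_iff, ← orderOf_dvd_iff_pow_eq_one]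
    exact (Nat.dvd_add_right dvd_rfl).1 hk
  · rw [← Multiset.card_eq_zero, Multiset.card_replicate] at h
    exact h

lemma isAtomSeq_pair {g h : G} (hgh : g * h = 1) (hg : g ≠ 1) :
    IsAtomSeq ({g, h} : Multiset G) := by
  have hh : h ≠ 1 := by
    rintro rfl
    exact hg (by simpa using hgh)
  have hsing : ∀ A : Multiset G, A ≤ {g, h} → IsProductOne A → Multiset.card A ≠ 1 := by
    intro A hA hP h1
    obtain ⟨x, rfl⟩ := Multiset.card_eq_one.1 h1
    have hx : x = g ∨ x = h := by simpa using Multiset.singleton_le.1 hA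
    have hx1 : x = 1 := by
      simpa using (isProductOne_replicate_iff (g := x) (k := 1)).1 (by simpa using hP)
    rcases hx with rfl | rfl
    exacts [hg hx1, hh hx1]
  refine ⟨by simp, ⟨[g, h], rfl, by simpa using hgh⟩, fun A B hAB hA hB => ?_⟩
  have h1 := hsing A (hAB ▸ Multiset.le_add_right _ _) hA
  have h2 := hsing B (hAB ▸ Multiset.le_add_left _ _) hB
  have hc := congrArg Multiset.card hAB
  simp only [Multiset.card_add, Multiset.insert_eq_cons, Multiset.card_cons,
    Multiset.card_singleton] at hc
  simp only [← Multiset.card_eq_zero]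
  omega

end SingleElement

section Dihedral

open DihedralGroup

variable {n : ℕ}

/-- The index of an element of the dihedral group. -/
def angle : DihedralGroup n → ZMod n
  | r i => i
  | sr i => i

lemma prod_rotations (l : List (DihedralGroup n)) (hl : ∀ g ∈ l, ∃ i, g = r i) :
    l.prod = r (l.map angle).sum := by
  induction l with
  | nil => rfl
  | cons g l ih =>
    obtain ⟨i, rfl⟩ := hl g (by simp)
    rw [List.prod_cons, ih fun h hh => hl h (by simp [hh])]
    simp [angle]

lemma isProductOne_rotations_iff {S : Multiset (DihedralGroup n)} (hS : ∀ g ∈ S, ∃ i, g = r i) :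
    IsProductOne S ↔ (S.map angle).sum = 0 := by
  constructor
  · rintro ⟨l, rfl, hp⟩
    rw [prod_rotations l hS, one_def, r.injEq] at hp
    simpa using hp
  · induction S using Quotient.inductionOn with
    | _ l =>
      intro h
      refine ⟨l, rfl, ?_⟩
      rw [prod_rotations l hS, one_def, r.injEq]
      simpa using h

lemma isProductOne_of_add_rotations {A B : Multiset (DihedralGroup n)}
    (hS : ∀ g ∈ A + B, ∃ i, g = r i) (hAB : IsProductOne (A + B)) (hA : IsProductOne A) :
    IsProductOne B := by
  rw [isProductOne_rotations_iff hS] at hAB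
  rw [isProductOne_rotations_iff fun g hg => hS g (Multiset.mem_add.2 (Or.inl hg))] at hA
  rw [isProductOne_rotations_iff fun g hg => hS g (Multiset.mem_add.2 (Or.inr hg))]
  simpa [hA] using hAB

lemma card_le_of_isAtomSeq_rotations [NeZero n] {U : Multiset (DihedralGroup n)}
    (hU : IsAtomSeq U) (hS : ∀ g ∈ U, ∃ i, g = r i) : Multiset.card U ≤ n := by
  by_contra! hlt
  obtain ⟨l, rfl, hp⟩ := hU.2.1
  rw [Multiset.coe_card] at hlt
  have hrot : ∀ i, (l.take i).prod = r ((l.take i).map angle).sum := fun i =>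
    prod_rotations _ fun g hg => hS g (List.mem_of_mem_take hg)
  obtain ⟨x, y, hxy, heq⟩ := Fintype.exists_ne_map_eq_of_card_lt
    (fun i : Fin (n + 1) => ((l.take i).map angle).sum) (by simp [ZMod.card])
  obtain ⟨i, j, hij, hj, hprod⟩ : ∃ i j : ℕ, i < j ∧ j ≤ n ∧ (l.take i).prod = (l.take j).prod := by
    rcases lt_or_gt_of_ne hxy with h | h
    · exact ⟨x, y, h, by omega, by rw [hrot, hrot]; exact congrArg r heq⟩
    · exact ⟨y, x, h, by omega, by rw [hrot, hrot]; exact congrArg r heq.symm⟩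
  have h1 : l.take j = l.take i ++ (l.take j).drop i := by
    conv_lhs => rw [← List.take_append_drop i (l.take j)]
    rw [List.take_take, min_eq_left hij.le]
  have hmid : ((l.take j).drop i).prod = 1 := by
    have := congrArg List.prod h1
    rw [List.prod_append, hprod] at this
    exact left_eq_mul.1 this
  have hout : (l.take i ++ l.drop j).prod = 1 := by
    rw [List.prod_append, hprod, ← List.prod_append, List.take_append_drop, hp]
  have hsplit : (l : Multiset (DihedralGroup n)) =
      (((l.take j).drop i : List _) : Multiset _) + ((l.take i ++ l.drop j : List _) : Multiset _) := by
    conv_lhs => rw [← List.take_append_drop j l, h1]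
    simp only [← Multiset.coe_add]
    abel
  rcases hU.2.2 _ _ hsplit ⟨_, rfl, hmid⟩ ⟨_, rfl, hout⟩ with h | h
  · have := congrArg Multiset.card h
    simp only [Multiset.coe_card, List.length_drop, List.length_take, Multiset.card_zero] at this
    omega
  · have := congrArg Multiset.card h
    simp only [Multiset.coe_card, List.length_append, List.length_drop, List.length_take,
      Multiset.card_zero] at this
    omega

/-- Products of the elements `sr b`, `sr (b + d)`, `r d` and `1`. -/
lemma exists_prod_eq {b d : ZMod n} (hd : d ≠ 0) (l : List (DihedralGroup n))
    (hl : ∀ g ∈ l, g = 1 ∨ g = sr b ∨ g = sr (b + d) ∨ g = r d) :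
    ∃ s : ℤ, |s| ≤ l.count (sr (b + d)) + l.count (r d) ∧
      2 ∣ s - (l.count (sr (b + d)) + l.count (r d)) ∧
      ((l.count (sr b) + l.count (sr (b + d))) % 2 = 0 ∧ l.prod = r ((s : ZMod n) * d) ∨
        (l.count (sr b) + l.count (sr (b + d))) % 2 = 1 ∧ l.prod = sr (b + (s : ZMod n) * d)) := by
  induction l with
  | nil => exact ⟨0, by simp⟩
  | cons g l ih =>
    obtain ⟨s, h1, h2, h3⟩ := ih fun h hh => hl h (List.mem_cons_of_mem _ hh)
    have hg1 : (1 : DihedralGroup n) ≠ r d := fun h =>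
      hd (r.inj (h.symm.trans one_def))
    have hgs : ∀ i, (1 : DihedralGroup n) ≠ sr i := fun i h => by
      rw [one_def] at h
      cases h
    rw [abs_le] at h1
    rw [List.prod_cons]
    simp only [abs_le]
    have hg := hl g List.mem_cons_self
    rcases h3 with ⟨hev, hp⟩ | ⟨hev, hp⟩ <;> rw [hp] <;> rcases hg with rfl | rfl | rfl | rfl
    · refine ⟨s, ?_⟩
      simp [hg1, hgs]
      omega
    · refine ⟨s, ?_⟩
      simp [hd]
      omega
    · refine ⟨s + 1, ?_⟩
      have h : b + d + s * d = b + ((s : ZMod n) + 1) * d := by ring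
      simp [hd, h]
      omega
    · refine ⟨s + 1, ?_⟩
      have h : d + s * d = ((s : ZMod n) + 1) * d := by ring
      simp [h]
      omega
    · refine ⟨s, ?_⟩
      simp [hg1, hgs]
      omega
    · refine ⟨s, ?_⟩
      simp [hd]
      omega
    · refine ⟨s - 1, ?_⟩
      have h : b + s * d - (b + d) = ((s : ZMod n) - 1) * d := by ring
      simp [hd, h]
      omega
    · refine ⟨s - 1, ?_⟩
      have h : b + s * d - d = b + ((s : ZMod n) - 1) * d := by ring
      simp [h]
      omega

lemma IsProductOne.exists_int {b d : ZMod n} (hd : d ≠ 0) {S : Multiset (DihedralGroup n)}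
    (hS : ∀ g ∈ S, g = 1 ∨ g = sr b ∨ g = sr (b + d) ∨ g = r d) (h : IsProductOne S) :
    (S.count (sr b) + S.count (sr (b + d))) % 2 = 0 ∧
    ∃ s : ℤ, |s| ≤ S.count (sr (b + d)) + S.count (r d) ∧
      2 ∣ s - (S.count (sr (b + d)) + S.count (r d)) ∧ (s : ZMod n) * d = 0 := by
  obtain ⟨l, rfl, hp⟩ := h
  obtain ⟨s, h1, h2, h3⟩ := exists_prod_eq hd l hS
  simp only [Multiset.coe_count]
  rw [hp, one_def] at h3
  rcases h3 with ⟨hev, h3⟩ | ⟨-, h3⟩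
  · exact ⟨hev, s, h1, h2, (r.inj h3).symm⟩
  · cases h3

/-- If the number of terms `sr (b + d)` and `r d` is odd, then there are at least `n` of them. -/
lemma IsProductOne.le_count {b d : ZMod n} (hd0 : d ≠ 0) (hd : addOrderOf d = n)
    {S : Multiset (DihedralGroup n)}
    (hS : ∀ g ∈ S, g = 1 ∨ g = sr b ∨ g = sr (b + d) ∨ g = r d) (h : IsProductOne S)
    (hodd : (S.count (sr (b + d)) + S.count (r d)) % 2 = 1) :
    n ≤ S.count (sr (b + d)) + S.count (r d) := by
  obtain ⟨-, s, h1, h2, h3⟩ := h.exists_int hd0 hS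
  rw [← zsmul_eq_mul, ← addOrderOf_dvd_iff_zsmul_eq_zero, hd] at h3
  have h4 := Int.le_of_dvd (abs_pos.2 (by omega)) ((dvd_abs _ _).2 h3)
  omega

lemma eq_replicate_add_replicate {α : Type*} [DecidableEq α] {x y : α} (hxy : x ≠ y)
    {S : Multiset α} (hS : ∀ g ∈ S, g = x ∨ g = y) :
    S = Multiset.replicate (S.count x) x + Multiset.replicate (S.count y) y := by
  ext g
  simp only [Multiset.count_add, Multiset.count_replicate]
  by_cases hx : x = g
  · subst hx
    simp [hxy.symm]
  by_cases hy : y = g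
  · subst hy
    simp [hx]
  · rw [Multiset.count_eq_zero_of_notMem fun hg => ?_]
    · simp [hx, hy]
    · rcases hS g hg with h | h
      exacts [hx h.symm, hy h.symm]

lemma sr_pow_eq_one {i : ZMod n} {k : ℕ} (hk : k % 2 = 0) : (sr i : DihedralGroup n) ^ k = 1 := by
  obtain ⟨j, rfl⟩ := Nat.dvd_of_mod_eq_zero hk
  rw [pow_mul, pow_two, sr_mul_self, one_pow]

lemma isAtomSeq_replicate_two_sr (i : ZMod n) :
    IsAtomSeq (Multiset.replicate 2 (sr i : DihedralGroup n)) := by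
  have h : orderOf (sr i : DihedralGroup n) = 2 := orderOf_sr i
  rw [← h]
  exact isAtomSeq_replicate_orderOf (orderOf_pos_iff.1 (by omega))

lemma exists_list_alternating (b d : ZMod n) (m : ℕ) :
    ∃ l : List (DihedralGroup n),
      (l : Multiset (DihedralGroup n)) =
        Multiset.replicate m (sr b) + Multiset.replicate m (sr (b + d)) ∧
      l.prod = r ((m : ZMod n) * d) := by
  induction m with
  | zero => exact ⟨[], by simp⟩
  | succ m ih =>
    obtain ⟨l, hl, hp⟩ := ih
    refine ⟨sr b :: sr (b + d) :: l, ?_, ?_⟩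
    · rw [← Multiset.cons_coe, ← Multiset.cons_coe, hl]
      simp [Multiset.replicate_succ, Multiset.cons_swap]
    · simp [hp]
      ring

lemma isProductOne_replicate_pair {b d : ZMod n} {m : ℕ} (hm : (m : ZMod n) * d = 0) :
    IsProductOne (Multiset.replicate m (sr b) + Multiset.replicate m (sr (b + d))) := by
  obtain ⟨l, hl, hp⟩ := exists_list_alternating b d m
  exact ⟨l, hl, by simp [hp, hm]⟩

/-- The atoms over `{1, sr b, sr (b + d)}`. -/
lemma IsAtomSeq.eq_of_two_reflections {b d : ZMod n} (hn : 3 ≤ n) (hodd : Odd n)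
    (hd : addOrderOf d = n) {U : Multiset (DihedralGroup n)} (hU : IsAtomSeq U)
    (hS : ∀ g ∈ U, g = 1 ∨ g = sr b ∨ g = sr (b + d)) :
    U = {1} ∨ U = Multiset.replicate 2 (sr b) ∨ U = Multiset.replicate 2 (sr (b + d)) ∨
      U = Multiset.replicate n (sr b) + Multiset.replicate n (sr (b + d)) := by
  by_cases h1 : (1 : DihedralGroup n) ∈ U
  · exact Or.inl (hU.eq_singleton_one h1)
  right
  have hd0 : d ≠ 0 := by
    rintro rfl
    simp at hd
    omega
  have hne : sr b ≠ sr (b + d) := by simpa using hd0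
  have hS1 : ∀ g ∈ U, g = sr b ∨ g = sr (b + d) := fun g hg =>
    (hS g hg).resolve_left fun h => h1 (h ▸ hg)
  have hS2 : ∀ g ∈ U, g = 1 ∨ g = sr b ∨ g = sr (b + d) ∨ g = r d := fun g hg =>
    (hS g hg).imp_right fun h => h.imp_right Or.inl
  have hS3 : ∀ g ∈ U, g = 1 ∨ g = sr (b + d) ∨ g = sr (b + d + -d) ∨ g = r (-d) := by
    intro g hg
    rw [add_neg_cancel_right]
    rcases hS1 g hg with h | h <;> simp [h]
  have hr : ∀ i : ZMod n, U.count (r i) = 0 := fun i =>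
    Multiset.count_eq_zero_of_notMem fun h => by rcases hS1 _ h with h | h <;> cases h
  have hpar := (hU.2.1.exists_int hd0 hS2).1
  have hy := hU.2.1.le_count hd0 hd hS2
  have hx := hU.2.1.le_count (neg_ne_zero.2 hd0) (by rw [addOrderOf_neg, hd]) hS3
  rw [add_neg_cancel_right] at hx
  rw [hr, add_zero] at hx hy
  have hrep := eq_replicate_add_replicate hne hS1
  have hodd' := Nat.odd_iff.1 hodd
  generalize U.count (sr b) = x at *
  generalize U.count (sr (b + d)) = y at *
  have hprod : ∀ k l : ℕ, k % 2 = 0 → l % 2 = 0 →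
      IsProductOne (Multiset.replicate k (sr b) + Multiset.replicate l (sr (b + d))) :=
    fun k l hk hl => (isProductOne_replicate_iff.2 (sr_pow_eq_one hk)).add
      (isProductOne_replicate_iff.2 (sr_pow_eq_one hl))
  rcases Nat.mod_two_eq_zero_or_one x with hx0 | hx1
  · rcases Nat.eq_zero_or_pos x with rfl | hxpos
    · have hypos : 0 < y := by
        by_contra h0
        exact hU.1 (by simpa [show y = 0 by omega] using hrep)
      obtain ⟨j, rfl⟩ := Nat.exists_eq_add_of_le (show 2 ≤ y by omega)
      refine Or.inr (Or.inl (hU.eq_of_add (B := Multiset.replicate j (sr (b + d))) ?_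
        (isAtomSeq_replicate_two_sr _).2.1
        (isProductOne_replicate_iff.2 (sr_pow_eq_one (by omega)))
        (isAtomSeq_replicate_two_sr _).1))
      rw [hrep, Multiset.replicate_add]
      simp
    · obtain ⟨j, rfl⟩ := Nat.exists_eq_add_of_le (show 2 ≤ x by omega)
      refine Or.inl (hU.eq_of_add (B := Multiset.replicate j (sr b) +
        Multiset.replicate y (sr (b + d))) ?_ (isAtomSeq_replicate_two_sr _).2.1
        (hprod _ _ (by omega) (by omega)) (isAtomSeq_replicate_two_sr _).1)
      rw [hrep, Multiset.replicate_add, add_assoc]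
  · obtain ⟨j, rfl⟩ := Nat.exists_eq_add_of_le (hx hx1)
    obtain ⟨k, rfl⟩ := Nat.exists_eq_add_of_le (hy (by omega))
    refine Or.inr (Or.inr (hU.eq_of_add (B := Multiset.replicate j (sr b) +
      Multiset.replicate k (sr (b + d))) ?_ (isProductOne_replicate_pair (by simp))
      (hprod _ _ (by omega) (by omega)) fun h => ?_))
    · rw [hrep, Multiset.replicate_add, Multiset.replicate_add]
      abel
    · have := congrArg Multiset.card h
      simp at this
      omega

/-- Over two reflections whose product has order `n`, all differences of lengths are divisible
by `2 * n - 2`. -/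
lemma dvd_lengthDiffs_two_reflections {b d : ZMod n} (hn : 3 ≤ n) (hodd : Odd n)
    (hd : addOrderOf d = n) {G₀ : Set (DihedralGroup n)}
    (hS : ∀ g ∈ G₀, g = 1 ∨ g = sr b ∨ g = sr (b + d)) {h : ℤ} (hh : h ∈ lengthDiffs G₀) :
    ((2 * n - 2 : ℕ) : ℤ) ∣ h := by
  have hd0 : d ≠ 0 := by
    rintro rfl
    simp at hd
    omega
  have hs : ∀ i, sr i ≠ (1 : DihedralGroup n) := fun i h => by
    rw [one_def] at h
    cases h
  obtain ⟨k, hk⟩ := hodd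
  rw [show ((2 * n - 2 : ℕ) : ℤ) = 2 * n - 2 by omega]
  refine dvd_of_mem_lengthDiffs
    (fun g => if g = 1 then 2 else if g = sr b then 1 - 2 * (n - 1) else 1) (fun U hU => ?_) hh
  rcases hU.2.eq_of_two_reflections hn ⟨k, hk⟩ hd fun g hg => hS g (hU.1 g hg) with
    rfl | rfl | rfl | rfl
  · simp
  · simp [hs]
    exact ⟨-1, by ring⟩
  · simp [hs, hd0]
  · simp [hs, hd0]
    exact ⟨-k, by rw [hk]; push_cast; ring⟩

lemma eq_zero_of_mem_lengthDiffs_one_reflection {b : ZMod n}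
    {G₀ : Set (DihedralGroup n)} (hS : ∀ g ∈ G₀, g = 1 ∨ g = sr b) {h : ℤ}
    (hh : h ∈ lengthDiffs G₀) : h = 0 := by
  have hs : ∀ i, sr i ≠ (1 : DihedralGroup n) := fun i h => by
    rw [one_def] at h
    cases h
  rw [← zero_dvd_iff]
  refine dvd_of_mem_lengthDiffs (fun g => if g = 1 then 2 else 1) (fun U hU => ?_) hh
  by_cases h1 : (1 : DihedralGroup n) ∈ U
  · simp [hU.2.eq_singleton_one h1]
  · have := hU.2.eq_replicate_orderOf (g := sr b) fun g hg =>
      (hS g (hU.1 g hg)).resolve_left fun h => h1 (h ▸ hg)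
    rw [orderOf_sr] at this
    simp [this, hs]

lemma card_mem_lengthsOn_two_nsmul {G₀ : Set (DihedralGroup n)} {A : Multiset (DihedralGroup n)}
    (hA : ∀ g ∈ A, g ∈ G₀ ∧ ∃ i, g = sr i) : Multiset.card A ∈ lengthsOn G₀ (2 • A) := by
  induction A using Multiset.induction_on with
  | empty => simpa using zero_mem_lengthsOn
  | cons g A ih =>
    obtain ⟨hg, i, rfl⟩ := hA g (Multiset.mem_cons_self _ _)
    have h1 := ih fun h hh => hA h (Multiset.mem_cons_of_mem hh)
    have h2 : IsAtomSeqOn G₀ (Multiset.replicate 2 (sr i)) :=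
      ⟨fun h hh => Multiset.eq_of_mem_replicate hh ▸ hg, isAtomSeq_replicate_two_sr i⟩
    have h3 := add_mem_lengthsOn h1 (one_mem_lengthsOn h2)
    rw [Multiset.card_cons, ← Multiset.singleton_add, nsmul_add, Multiset.nsmul_singleton,
      add_comm _ (2 • A)]
    exact h3

/-- A factorization of a sequence of reflections with a term of odd multiplicity has an atom
with more than two terms. -/
lemma two_mul_card_lt {G₀ : Set (DihedralGroup n)} {z : Multiset (Multiset (DihedralGroup n))}
    (hz : ∀ U ∈ z, IsAtomSeqOn G₀ U) (hA : ∀ g ∈ z.sum, ∃ i, g = sr i) {g : DihedralGroup n}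
    (hg : z.sum.count g % 2 = 1) : 2 * Multiset.card z < Multiset.card z.sum := by
  have key : 2 * Multiset.card z ≤ Multiset.card z.sum ∧
      (2 * Multiset.card z = Multiset.card z.sum → z.sum.count g % 2 = 0) := by
    clear hg
    induction z using Multiset.induction_on with
    | empty => simp
    | cons U z ih =>
      rw [Multiset.sum_cons] at hA ⊢
      obtain ⟨h1, h2⟩ := ih (fun V hV => hz V (Multiset.mem_cons_of_mem hV))
        fun x hx => hA x (Multiset.mem_add.2 (Or.inr hx))
      have hU := hz U (Multiset.mem_cons_self _ _)
      have hUpos := Multiset.card_pos.2 hU.2.1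
      obtain ⟨l, rfl, hp⟩ := hU.2.2.1
      simp only [Multiset.card_cons, Multiset.card_add, Multiset.count_add, Multiset.coe_card,
        Multiset.coe_count] at hUpos ⊢
      have hl : ∀ x ∈ l, ∃ i, x = sr i := fun x hx => hA x (Multiset.mem_add.2 (Or.inl hx))
      match l, hl, hp with
      | [], _, _ => simp at hUpos
      | [x], hl, hp =>
        obtain ⟨i, rfl⟩ := hl x (by simp)
        rw [List.prod_singleton, one_def] at hp
        cases hp
      | [x, y], hl, hp =>
        obtain ⟨i, rfl⟩ := hl x (by simp)
        obtain ⟨j, rfl⟩ := hl y (by simp)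
        have hij : j - i = 0 := r.inj (by simpa using hp)
        obtain rfl := sub_eq_zero.1 hij
        simp only [List.count_cons, List.count_nil, List.length_cons, List.length_nil]
        split_ifs <;> omega
      | x :: y :: w :: l, _, _ =>
        simp only [List.length_cons]
        omega
  omega

lemma exists_mem_lengthDiffs_of_reflections {G₀ : Set (DihedralGroup n)}
    {A : Multiset (DihedralGroup n)} (hA : ∀ g ∈ A, g ∈ G₀ ∧ ∃ i, g = sr i)
    (hP : IsProductOne A) {g : DihedralGroup n} (hg : A.count g % 2 = 1) :
    ∃ d : ℕ, 0 < d ∧ d + 2 ≤ Multiset.card A ∧ (d : ℤ) ∈ lengthDiffs G₀ := by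
  obtain ⟨z, hz, rfl⟩ := hP.exists_factorization (G₀ := G₀) fun g hg => (hA g hg).1
  have hlt := two_mul_card_lt hz (fun g hg => (hA g hg).2) hg
  have hz0 : 0 < Multiset.card z := by
    rw [Multiset.card_pos]
    rintro rfl
    simp at hg
  refine ⟨Multiset.card z.sum - 2 * Multiset.card z, by omega, by omega, ?_⟩
  have h := sub_mem_lengthDiffs (card_mem_lengthsOn_two_nsmul hA)
    (nsmul_mem_lengthsOn 2 ⟨z, rfl, hz, rfl⟩)
  rwa [Nat.cast_sub hlt.le]

lemma isProductOne_two_reflections_rotations (b d : ZMod n) (k : ℕ) :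
    IsProductOne (Multiset.replicate 2 (sr b) + Multiset.replicate (2 * k) (r d)) := by
  refine ⟨List.replicate k (r d) ++ [sr b] ++ List.replicate k (r d) ++ [sr b], ?_, by simp⟩
  rw [two_mul, Multiset.replicate_add]
  simp only [← Multiset.coe_add, Multiset.coe_replicate, Multiset.coe_singleton,
    Multiset.replicate_succ, Multiset.replicate_zero, ← Multiset.singleton_add]
  abel

lemma isOfFinOrder_r [NeZero n] (d : ZMod n) : IsOfFinOrder (r d : DihedralGroup n) :=
  isOfFinOrder_of_finite _

lemma two_mem_lengthDiffs [NeZero n] (hodd : Odd n) {b d : ZMod n} (hd : d ≠ 0)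
    {G₀ : Set (DihedralGroup n)} (hb : sr b ∈ G₀) (hr : r d ∈ G₀) : (2 : ℤ) ∈ lengthDiffs G₀ := by
  set m := orderOf (r d : DihedralGroup n) with hm
  have hmn : m ∣ n := orderOf_dvd_of_pow_eq_one (by simp)
  have hmodd : m % 2 = 1 := Nat.odd_iff.1 (hodd.of_dvd_nat hmn)
  have hm1 : m ≠ 1 := fun h => hd (r.inj ((orderOf_eq_one_iff.1 h).trans one_def))
  have hne : (sr b : DihedralGroup n) ≠ r d := by simp
  have hatom : IsAtomSeq (Multiset.replicate 2 (sr b) + Multiset.replicate 2 (r d)) := by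
    have hmem : ∀ g ∈ Multiset.replicate 2 (sr b) + Multiset.replicate 2 (r d),
        g = sr b ∨ g = r d := by
      intro g hg
      rcases Multiset.mem_add.1 hg with h | h
      exacts [Or.inl (Multiset.eq_of_mem_replicate h), Or.inr (Multiset.eq_of_mem_replicate h)]
    have hzero : ∀ A ≤ Multiset.replicate 2 (sr b) + Multiset.replicate 2 (r d),
        IsProductOne A → A.count (sr b) = 0 → A = 0 := by
      intro A hA hP h0
      have hrep := eq_replicate_add_replicate hne fun g hg => hmem g (Multiset.mem_of_le hA hg)
      have hle := Multiset.count_le_of_le (r d) hA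
      rw [h0, Multiset.replicate_zero, zero_add] at hrep
      rw [hrep, isProductOne_replicate_iff] at hP
      have hdvd := orderOf_dvd_of_pow_eq_one hP
      simp at hle
      have : A.count (r d) = 0 := by
        by_contra h
        have := Nat.le_of_dvd (Nat.pos_of_ne_zero h) hdvd
        omega
      rw [hrep, this, Multiset.replicate_zero]
    have heven : ∀ A ≤ Multiset.replicate 2 (sr b) + Multiset.replicate 2 (r d),
        IsProductOne A → A.count (sr b) % 2 = 0 := by
      intro A hA hP
      have hcount : A.count (sr (b + d)) = 0 := by
        refine Multiset.count_eq_zero_of_notMem fun h => ?_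
        rcases hmem _ (Multiset.mem_of_le hA h) with h | h
        · exact hd (by simpa using h)
        · cases h
      have := (hP.exists_int (b := b) hd fun g hg => by
        rcases hmem g (Multiset.mem_of_le hA hg) with h | h <;> simp [h]).1
      rwa [hcount, add_zero] at this
    refine ⟨by simp [← Multiset.card_eq_zero], isProductOne_two_reflections_rotations b d 1,
      fun A B hAB hA hB => ?_⟩
    have hAle := hAB ▸ Multiset.le_add_right A B
    have hBle := hAB ▸ Multiset.le_add_left B A
    have hA2 := heven A hAle hA
    have hB2 := heven B hBle hB
    have hc := congrArg (Multiset.count (sr b)) hAB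
    simp at hc
    by_cases h0 : A.count (sr b) = 0
    · exact Or.inl (hzero A hAle hA h0)
    · exact Or.inr (hzero B hBle hB (by omega))
  have h1 : m * 1 ∈ lengthsOn G₀
      (m • (Multiset.replicate 2 (sr b) + Multiset.replicate 2 (r d))) := by
    refine nsmul_mem_lengthsOn m (one_mem_lengthsOn ⟨fun g hg => ?_, hatom⟩)
    rcases Multiset.mem_add.1 hg with h | h <;> rw [Multiset.eq_of_mem_replicate h] <;> assumption
  have h2 : m * 1 + 2 * 1 ∈ lengthsOn G₀
      (m • Multiset.replicate 2 (sr b) + 2 • Multiset.replicate m (r d)) := by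
    refine add_mem_lengthsOn
      (nsmul_mem_lengthsOn m (one_mem_lengthsOn ⟨fun g hg => ?_, isAtomSeq_replicate_two_sr b⟩))
      (nsmul_mem_lengthsOn 2 (one_mem_lengthsOn
        ⟨fun g hg => ?_, isAtomSeq_replicate_orderOf (isOfFinOrder_r d)⟩)) <;>
    rw [Multiset.eq_of_mem_replicate hg] <;> assumption
  rw [nsmul_add, Multiset.nsmul_replicate m 2 (a := r d), mul_comm m 2,
    ← Multiset.nsmul_replicate 2 m] at h1
  simpa using sub_mem_lengthDiffs h2 h1

lemma two_dvd_lengthDiffs (hn : 3 ≤ n) (hodd : Odd n) {h : ℤ}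
    (hh : h ∈ lengthDiffs ({sr 0, r 1} : Set (DihedralGroup n))) : 2 ∣ h := by
  have : Fact (1 < n) := ⟨by omega⟩
  have hodd' := Nat.odd_iff.1 hodd
  have hne : (sr 0 : DihedralGroup n) ≠ r 1 := by simp
  refine dvd_of_mem_lengthDiffs (fun g => if g = sr 0 then 1 else 2) (fun U hU => ?_) hh
  have hmem : ∀ g ∈ U, g = sr 0 ∨ g = r 1 := fun g hg => by simpa using hU.1 g hg
  have hmem' : ∀ g ∈ U, g = 1 ∨ g = sr 0 ∨ g = sr (0 + 1) ∨ g = r 1 := fun g hg => by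
    rcases hmem g hg with h | h <;> simp [h]
  have hcount : U.count (sr (0 + 1)) = 0 := by
    refine Multiset.count_eq_zero_of_notMem fun h => ?_
    rcases hmem _ h with h | h <;> simp at h
  have hrep := eq_replicate_add_replicate hne hmem
  have hev := (hU.2.2.1.exists_int one_ne_zero hmem').1
  have hle := hU.2.2.1.le_count one_ne_zero (ZMod.addOrderOf_one n) hmem'
  rw [hcount] at hev hle
  have hsum : (U.map fun g => if g = sr 0 then (1 : ℤ) else 2).sum =
      U.count (sr 0) + 2 * U.count (r 1) := by
    conv_lhs => rw [hrep]
    simp [mul_comm]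
  rw [hsum]
  generalize U.count (sr 0) = c at *
  generalize U.count (r 1) = x at *
  have hP : ∀ y, y % 2 = 0 → ∀ e, e % 2 = 0 → 2 ≤ e →
      IsProductOne (Multiset.replicate e (sr 0 : DihedralGroup n) +
        Multiset.replicate y (r 1)) := by
    intro y hy e he he2
    obtain ⟨k, rfl⟩ := Nat.dvd_of_mod_eq_zero hy
    obtain ⟨j, rfl⟩ := Nat.exists_eq_add_of_le he2
    rw [Multiset.replicate_add, add_right_comm]
    exact (isProductOne_two_reflections_rotations 0 1 k).add
      (isProductOne_replicate_iff.2 (sr_pow_eq_one (by omega)))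
  rcases Nat.eq_zero_or_pos c with rfl | hc
  · rw [Multiset.replicate_zero, zero_add] at hrep
    have h1 := hU.2.eq_replicate_orderOf (g := r 1) fun g hg =>
      Multiset.eq_of_mem_replicate (hrep ▸ hg)
    rw [orderOf_r_one] at h1
    have h2 := congrArg Multiset.card (hrep.symm.trans h1)
    simp only [Multiset.card_replicate] at h2
    omega
  rcases Nat.mod_two_eq_zero_or_one x with hx | hx
  · by_cases hc2 : c = 2
    · omega
    obtain ⟨j, rfl⟩ := Nat.exists_eq_add_of_le (show 2 ≤ c by omega)
    have h1 := hU.2.eq_of_add (A := Multiset.replicate 2 (sr 0))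
      (by rw [hrep, Multiset.replicate_add, add_assoc])
      (isAtomSeq_replicate_two_sr _).2.1 (hP x hx j (by omega) (by omega))
      (isAtomSeq_replicate_two_sr _).1
    have h2 := congrArg Multiset.card (hrep.symm.trans h1)
    simp at h2
    omega
  · obtain ⟨j, rfl⟩ := Nat.exists_eq_add_of_le (show n ≤ x by omega)
    have h1 := hU.2.eq_of_add (A := Multiset.replicate n (r 1))
      (by rw [hrep, Multiset.replicate_add, add_left_comm])
      (isProductOne_replicate_iff.2 (by simp)) (hP j (by omega) c (by omega) (by omega))
      (Multiset.card_pos.1 (by rw [Multiset.card_replicate]; omega))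
    have h2 := congrArg Multiset.card (hrep.symm.trans h1)
    simp at h2
    omega

lemma orderOf_r_neg_one : orderOf (r (-1) : DihedralGroup n) = n := by
  rw [← inv_r, orderOf_inv, orderOf_r_one]

lemma sub_two_mem_lengthDiffs (hn : 3 ≤ n) {G₀ : Set (DihedralGroup n)} (h1 : r 1 ∈ G₀)
    (h2 : r (-1) ∈ G₀) : ((n - 2 : ℕ) : ℤ) ∈ lengthDiffs G₀ := by
  have : NeZero n := ⟨by omega⟩
  have : Fact (1 < n) := ⟨by omega⟩
  have hatom : ∀ i : ZMod n, r i ∈ G₀ → orderOf (r i : DihedralGroup n) = n →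
      IsAtomSeqOn G₀ (Multiset.replicate n (r i)) := by
    intro i hi ho
    refine ⟨fun g hg => Multiset.eq_of_mem_replicate hg ▸ hi, ?_⟩
    have := isAtomSeq_replicate_orderOf (isOfFinOrder_r i)
    rwa [ho] at this
  have hpair : IsAtomSeqOn G₀ ({r 1, r (-1)} : Multiset (DihedralGroup n)) := by
    refine ⟨fun g hg => ?_, isAtomSeq_pair (by simp) fun h => ?_⟩
    · rcases (by simpa using hg : g = r 1 ∨ g = r (-1)) with rfl | rfl <;> assumption
    · exact one_ne_zero (r.inj (h.trans one_def))
  have hA := add_mem_lengthsOn (one_mem_lengthsOn (hatom 1 h1 orderOf_r_one))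
    (one_mem_lengthsOn (hatom (-1) h2 orderOf_r_neg_one))
  have hB := nsmul_mem_lengthsOn n (one_mem_lengthsOn hpair)
  rw [Multiset.insert_eq_cons, ← Multiset.singleton_add, nsmul_add, Multiset.nsmul_singleton,
    Multiset.nsmul_singleton] at hB
  have := sub_mem_lengthDiffs hB hA
  rw [Nat.cast_sub (by omega)]
  rwa [mul_one] at this

lemma sub_two_dvd_lengthDiffs (hn : 3 ≤ n) (hodd : Odd n) {h : ℤ}
    (hh : h ∈ lengthDiffs ({r 1, r (-1)} : Set (DihedralGroup n))) : ((n - 2 : ℕ) : ℤ) ∣ h := by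
  obtain ⟨k, hk⟩ := hodd
  rw [Nat.cast_sub (by omega), Nat.cast_ofNat]
  refine dvd_of_mem_lengthDiffs (fun _ => (n : ℤ) - 1) (fun U hU => ?_) hh
  have hmem : ∀ g ∈ U, g = r 1 ∨ g = r (-1) := fun g hg => by simpa using hU.1 g hg
  have hcard : Multiset.card U = 2 ∨ Multiset.card U = n := by
    by_cases hp : r 1 ∈ U
    · by_cases hm : r (-1) ∈ U
      · by_cases heq : (r 1 : DihedralGroup n) = r (-1)
        · right
          rw [hU.2.eq_replicate_orderOf (g := r 1) fun g hg => by
            rcases hmem g hg with h | h <;> simp [h, ← heq], orderOf_r_one, Multiset.card_replicate]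
        left
        obtain ⟨T, rfl⟩ := Multiset.exists_cons_of_mem hp
        obtain ⟨W, rfl⟩ := Multiset.exists_cons_of_mem
          ((Multiset.mem_cons.1 hm).resolve_left (Ne.symm heq))
        have hsplit : r 1 ::ₘ r (-1) ::ₘ W = {r 1, r (-1)} + W := by
          simp [Multiset.insert_eq_cons]
        have hpair : IsProductOne ({r 1, r (-1)} : Multiset (DihedralGroup n)) :=
          ⟨[r 1, r (-1)], rfl, by simp⟩
        have hrot : ∀ g ∈ ({r 1, r (-1)} + W : Multiset (DihedralGroup n)), ∃ i, g = r i := by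
          intro g hg
          rcases hmem g (hsplit ▸ hg) with h | h
          exacts [⟨_, h⟩, ⟨_, h⟩]
        rw [hU.2.eq_of_add hsplit hpair
          (isProductOne_of_add_rotations hrot (hsplit ▸ hU.2.2.1) hpair) (by simp)]
        simp
      · right
        rw [hU.2.eq_replicate_orderOf (g := r 1) fun g hg =>
          (hmem g hg).resolve_right fun h => hm (h ▸ hg), orderOf_r_one, Multiset.card_replicate]
    · right
      rw [hU.2.eq_replicate_orderOf (g := r (-1)) fun g hg =>
        (hmem g hg).resolve_left fun h => hp (h ▸ hg), orderOf_r_neg_one, Multiset.card_replicate]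
  rw [Multiset.map_const', Multiset.sum_replicate, nsmul_eq_mul]
  rcases hcard with h | h <;> rw [h]
  · exact ⟨1, by push_cast; ring⟩
  · exact ⟨k + 1, by rw [hk]; push_cast; ring⟩

lemma sInf_deltaOn_le_of_reflections {G₀ : Set (DihedralGroup n)}
    {A : Multiset (DihedralGroup n)} (hA : ∀ g ∈ A, g ∈ G₀ ∧ ∃ i, g = sr i)
    (hP : IsProductOne A) {g : DihedralGroup n} (hg : A.count g % 2 = 1) :
    sInf (DeltaOn G₀) + 2 ≤ Multiset.card A := by
  obtain ⟨d, hd, hle, hmem⟩ := exists_mem_lengthDiffs_of_reflections hA hP hg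
  have := sInf_deltaOn_le hd hmem
  omega

lemma sInf_deltaOn_le_of_pair {G₀ : Set (DihedralGroup n)} {b d : ZMod n} (hd0 : d ≠ 0) {m : ℕ}
    (hm : m % 2 = 1) (hmd : (m : ZMod n) * d = 0) (hb : sr b ∈ G₀) (hc : sr (b + d) ∈ G₀) :
    sInf (DeltaOn G₀) ≤ 2 * m - 2 := by
  have := sInf_deltaOn_le_of_reflections (G₀ := G₀)
    (A := Multiset.replicate m (sr b) + Multiset.replicate m (sr (b + d))) (g := sr b)
    (fun g hg => ?_) (isProductOne_replicate_pair hmd)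
    (by simpa [Multiset.count_replicate, hd0] using hm)
  · simp at this
    omega
  · rcases Multiset.mem_add.1 hg with h | h <;> rw [Multiset.eq_of_mem_replicate h]
    exacts [⟨hb, _, rfl⟩, ⟨hc, _, rfl⟩]

lemma sInf_deltaOn_le_of_triple (hn : 3 ≤ n) (hodd : Odd n) {G₀ : Set (DihedralGroup n)}
    {b d x : ZMod n} (hd : addOrderOf d = n) (hb : sr b ∈ G₀) (hc : sr (b + d) ∈ G₀)
    (hx : sr x ∈ G₀) (hxb : x ≠ b) (hxc : x ≠ b + d) :
    sInf (DeltaOn G₀) ≤ max 2 (n - 2) := by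
  have : NeZero n := ⟨by omega⟩
  have hd0 : d ≠ 0 := by
    rintro rfl
    simp at hd
    omega
  obtain ⟨k, hkn, rfl⟩ : ∃ k < n, x = b + (k : ZMod n) * d := by
    have hmem : x - b ∈ AddSubgroup.zmultiples d := by
      rw [AddSubgroup.eq_top_of_card_eq (AddSubgroup.zmultiples d)
        (by rw [Nat.card_zmultiples, hd, Nat.card_zmod])]
      trivial
    obtain ⟨k, hk, hkd⟩ := (mem_zmultiples_iff_mem_range_addOrderOf (x := d)).1 hmem
      |> Finset.mem_image.1
    refine ⟨k, by simpa [hd] using hk, ?_⟩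
    rw [← nsmul_eq_mul, hkd]
    ring
  have hk0 : k ≠ 0 := by
    rintro rfl
    simp at hxb
  have hk1 : k ≠ 1 := by
    rintro rfl
    simp at hxc
  have hnd : (n : ZMod n) * d = 0 := by simp
  have hodd' := Nat.odd_iff.1 hodd
  set x := b + (k : ZMod n) * d with hxdef
  have hsx : ∀ y, (sr y : DihedralGroup n) = sr x ↔ y = x := fun y => by simp
  rcases lt_trichotomy (2 * k) (n + 1) with hk | hk | hk
  · obtain ⟨l, hl, hp⟩ := exists_list_alternating b d (k - 1)
    have := sInf_deltaOn_le_of_reflections (G₀ := G₀) (g := sr x)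
      (A := Multiset.replicate (k - 1) (sr b) + Multiset.replicate (k - 1) (sr (b + d)) +
        {sr x, sr (b + d)}) (fun g hg => ?_) ⟨l ++ [sr x, sr (b + d)], ?_, ?_⟩ ?_
    · simp at this
      omega
    · simp only [Multiset.mem_add, Multiset.mem_replicate, Multiset.insert_eq_cons,
        Multiset.mem_cons, Multiset.mem_singleton] at hg
      rcases hg with (⟨-, rfl⟩ | ⟨-, rfl⟩) | rfl | rfl
      exacts [⟨hb, _, rfl⟩, ⟨hc, _, rfl⟩, ⟨hx, _, rfl⟩, ⟨hc, _, rfl⟩]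
    · rw [← Multiset.coe_add, hl]
      rfl
    · have h0 : ((k - 1 : ℕ) : ZMod n) * d + (b + d - x) = 0 := by
        rw [Nat.cast_sub (by omega), hxdef]
        push_cast
        ring
      simp [hp, h0]
    · simp [Multiset.count_replicate, hsx, hxc, Ne.symm hxb, Ne.symm hxc]
  · have hmid : x + (x - (b + d)) - b = 0 := by
      have h1 : (2 * k : ZMod n) = n + 1 := by exact_mod_cast congrArg (Nat.cast (R := ZMod n)) hk
      have h2 : x + (x - (b + d)) - b = (2 * k : ZMod n) * d - d := by
        rw [hxdef]
        ring
      rw [h2, h1]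
      simp
    have := sInf_deltaOn_le_of_reflections (G₀ := G₀) (g := sr b)
      (A := ([sr b, sr x, sr (b + d), sr x] : List _)) (fun g hg => ?_) ⟨_, rfl, ?_⟩ ?_
    · simp at this
      omega
    · simp only [Multiset.mem_coe, List.mem_cons, List.not_mem_nil, or_false] at hg
      rcases hg with rfl | rfl | rfl | rfl
      exacts [⟨hb, _, rfl⟩, ⟨hx, _, rfl⟩, ⟨hc, _, rfl⟩, ⟨hx, _, rfl⟩]
    · simp [hmid]
    · simp [hxb, hd0]
  · obtain ⟨l, hl, hp⟩ := exists_list_alternating b d (n - k)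
    have := sInf_deltaOn_le_of_reflections (G₀ := G₀) (g := sr x)
      (A := Multiset.replicate (n - k) (sr b) + Multiset.replicate (n - k) (sr (b + d)) +
        {sr b, sr x}) (fun g hg => ?_) ⟨l ++ [sr b, sr x], ?_, ?_⟩ ?_
    · simp at this
      omega
    · simp only [Multiset.mem_add, Multiset.mem_replicate, Multiset.insert_eq_cons,
        Multiset.mem_cons, Multiset.mem_singleton] at hg
      rcases hg with (⟨-, rfl⟩ | ⟨-, rfl⟩) | rfl | rfl
      exacts [⟨hb, _, rfl⟩, ⟨hc, _, rfl⟩, ⟨hb, _, rfl⟩, ⟨hx, _, rfl⟩]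
    · rw [← Multiset.coe_add, hl]
      rfl
    · have h0 : ((n - k : ℕ) : ZMod n) * d + (x - b) = 0 := by
        rw [Nat.cast_sub hkn.le, hxdef, sub_mul, hnd]
        ring
      simp [hp, h0]
    · simp [Multiset.count_replicate, hsx, hxb, Ne.symm hxb, Ne.symm hxc]

/-- The upper bound for `min Δ(G₀)`. -/
lemma sInf_deltaOn_eq_or_le (hn : 3 ≤ n) (hodd : Odd n) {G₀ : Set (DihedralGroup n)}
    (hne : (DeltaOn G₀).Nonempty) :
    sInf (DeltaOn G₀) = 2 * n - 2 ∨ sInf (DeltaOn G₀) ≤ max 2 (n - 2) := by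
  have : NeZero n := ⟨by omega⟩
  obtain ⟨hpos, hself⟩ := pos_and_mem_lengthDiffs_of_mem_deltaOn (Nat.sInf_mem hne)
  by_cases hrot : ∀ g ∈ G₀, ∃ i, g = r i
  · obtain ⟨d, hd, hle, hmem⟩ := exists_mem_lengthDiffs_le (G₀ := G₀) (n := n)
      (fun U hU => card_le_of_isAtomSeq_rotations hU.2 fun g hg => hrot g (hU.1 g hg))
      (fun A B hS hAB hA => isProductOne_of_add_rotations (fun g hg => hrot g (hS g hg)) hAB hA)
      hne
    exact Or.inr (((sInf_deltaOn_le hd hmem).trans hle).trans (le_max_right _ _))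
  push Not at hrot
  obtain ⟨g, hb, hg⟩ := hrot
  obtain ⟨b, rfl⟩ : ∃ b, g = sr b := by
    cases g with
    | r i => exact absurd rfl (hg i)
    | sr i => exact ⟨i, rfl⟩
  by_cases hr : ∃ d, d ≠ 0 ∧ r d ∈ G₀
  · obtain ⟨d, hd, hrd⟩ := hr
    exact Or.inr ((sInf_deltaOn_le two_pos (two_mem_lengthDiffs hodd hd hb hrd)).trans
      (le_max_left _ _))
  have hr1 : ∀ i, r i ∈ G₀ → r i = 1 := fun i hi => by
    rw [one_def, r.injEq]
    exact not_not.1 fun h => hr ⟨i, h, hi⟩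
  by_cases hc : ∃ d, d ≠ 0 ∧ sr (b + d) ∈ G₀
  swap
  · refine absurd (eq_zero_of_mem_lengthDiffs_one_reflection (b := b) (fun g hg => ?_) hself)
      (by exact_mod_cast hpos.ne')
    cases g with
    | r i => exact Or.inl (hr1 i hg)
    | sr i =>
      refine Or.inr (congrArg sr (not_not.1 fun h => hc ⟨i - b, sub_ne_zero.2 h, ?_⟩))
      rwa [add_sub_cancel]
  obtain ⟨d, hd0, hc⟩ := hc
  have hdvd : addOrderOf d ∣ n := addOrderOf_dvd_of_nsmul_eq_zero (by simp)
  have hle : sInf (DeltaOn G₀) ≤ 2 * addOrderOf d - 2 :=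
    sInf_deltaOn_le_of_pair hd0 (Nat.odd_iff.1 (hodd.of_dvd_nat hdvd))
      (by rw [← nsmul_eq_mul, addOrderOf_nsmul_eq_zero]) hb hc
  by_cases hd : addOrderOf d = n
  swap
  · obtain ⟨q, hq⟩ := hdvd
    have hq2 : 2 ≤ q := by
      by_contra! h
      interval_cases q <;> omega
    have := Nat.mul_le_mul_left (addOrderOf d) hq2
    right
    omega
  by_cases hx : ∃ x, x ≠ b ∧ x ≠ b + d ∧ sr x ∈ G₀
  · obtain ⟨x, hxb, hxc, hx⟩ := hx
    exact Or.inr (sInf_deltaOn_le_of_triple hn hodd hd hb hc hx hxb hxc)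
  · left
    have h := dvd_lengthDiffs_two_reflections (b := b) hn hodd hd (fun g hg => ?_) hself
    · rw [hd] at hle
      exact le_antisymm hle (Nat.le_of_dvd hpos (by exact_mod_cast h))
    · cases g with
      | r i => exact Or.inl (hr1 i hg)
      | sr i =>
        by_contra! h
        exact hx ⟨i, fun h' => h.2.1 (congrArg sr h'), fun h' => h.2.2 (congrArg sr h'), hg⟩

lemma one_mem_deltaStar (hn : 3 ≤ n) (hodd : Odd n) : 1 ∈ DeltaStar (DihedralGroup n) := by
  have : NeZero n := ⟨by omega⟩
  have : Fact (1 < n) := ⟨by omega⟩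
  have h1 := sub_two_mem_lengthDiffs hn (Set.mem_univ _) (Set.mem_univ _)
  have h2 := two_mem_lengthDiffs hodd (b := 0) (d := 1) one_ne_zero (Set.mem_univ _)
    (Set.mem_univ _)
  obtain ⟨k, hk⟩ := hodd
  refine mem_deltaStar_of_lengthDiffs (G₀ := Set.univ) one_pos ?_ fun h _ => by simp
  have h3 := sub_mem h1 (AddSubgroup.zsmul_mem _ h2 (k - 1))
  convert h3 using 1
  rw [smul_eq_mul]
  omega

lemma two_mem_deltaStar (hn : 3 ≤ n) (hodd : Odd n) : 2 ∈ DeltaStar (DihedralGroup n) := by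
  have : NeZero n := ⟨by omega⟩
  have : Fact (1 < n) := ⟨by omega⟩
  exact mem_deltaStar_of_lengthDiffs (G₀ := {sr 0, r 1}) two_pos
    (two_mem_lengthDiffs hodd (b := 0) (d := 1) one_ne_zero (by simp) (by simp))
    fun h hh => two_dvd_lengthDiffs hn hodd hh

lemma sub_two_mem_deltaStar (hn : 3 ≤ n) (hodd : Odd n) :
    n - 2 ∈ DeltaStar (DihedralGroup n) :=
  mem_deltaStar_of_lengthDiffs (G₀ := {r 1, r (-1)}) (by omega)
    (sub_two_mem_lengthDiffs hn (by simp) (by simp))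
    fun _ hh => sub_two_dvd_lengthDiffs hn hodd hh

lemma two_mul_sub_two_mem_deltaStar (hn : 3 ≤ n) (hodd : Odd n) :
    2 * n - 2 ∈ DeltaStar (DihedralGroup n) := by
  have : Fact (1 < n) := ⟨by omega⟩
  have hdvd : ∀ h ∈ lengthDiffs ({sr 0, sr (0 + 1)} : Set (DihedralGroup n)),
      ((2 * n - 2 : ℕ) : ℤ) ∣ h := fun h hh =>
    dvd_lengthDiffs_two_reflections (b := 0) (d := 1) hn hodd (ZMod.addOrderOf_one n)
      (fun g hg => Or.inr (by simpa using hg)) hh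
  obtain ⟨d, hd, hle, hmem⟩ := exists_mem_lengthDiffs_of_reflections
    (G₀ := ({sr 0, sr (0 + 1)} : Set (DihedralGroup n))) (g := sr 0)
    (A := Multiset.replicate n (sr 0) + Multiset.replicate n (sr (0 + 1)))
    (fun g hg => by
      rcases Multiset.mem_add.1 hg with h | h <;> rw [Multiset.eq_of_mem_replicate h] <;> simp)
    (isProductOne_replicate_pair (by simp))
    (by simpa [Multiset.count_replicate] using Nat.odd_iff.1 hodd)
  have h1 : 2 * n - 2 ≤ d := Nat.le_of_dvd hd (by exact_mod_cast hdvd d hmem)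
  simp only [Multiset.card_add, Multiset.card_replicate] at hle
  obtain rfl : d = 2 * n - 2 := by omega
  exact mem_deltaStar_of_lengthDiffs hd hmem hdvd

end Dihedral

end ProductOne

open ProductOne in
/-- Let `G` be a dihedral group of order `2n`, `n ≥ 3` odd. Then
`{1, 2, n-2, 2n-2} ⊆ Δ*(G)` and `max (Δ*(G) \\ {2n-2}) = max {2, n-2}`. -/
theorem deltaStar_dihedral (n : ℕ) (hn : 3 ≤ n) (hodd : Odd n) :
    ({1, 2, n - 2, 2 * n - 2} : Set ℕ) ⊆ DeltaStar (DihedralGroup n) ∧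
    sSup (DeltaStar (DihedralGroup n) \ {2 * n - 2}) = max 2 (n - 2) := by
  constructor
  · rintro _ (rfl | rfl | rfl | rfl)
    exacts [one_mem_deltaStar hn hodd, two_mem_deltaStar hn hodd, sub_two_mem_deltaStar hn hodd,
      two_mul_sub_two_mem_deltaStar hn hodd]
  · refine IsGreatest.csSup_eq ⟨⟨?_, ?_⟩, ?_⟩
    · rcases max_choice 2 (n - 2) with h | h <;> rw [h]
      exacts [two_mem_deltaStar hn hodd, sub_two_mem_deltaStar hn hodd]
    · rw [Set.mem_singleton_iff]
      omega
    · rintro _ ⟨⟨G₀, hne, rfl⟩, hd⟩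
      exact (sInf_deltaOn_eq_or_le hn hodd hne).resolve_left hd
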